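/- Value decomposition for feasible m-uniform strategies: let β₋ be a competing-bid profile and b = ⟨(b_1,q_1),…,(b_m,q_m)⟩ an m-uniform strategy that satisfies the RoI constraint against β₋. Then V(b;β₋) = max_{ℓ ∈ {1,…,m}} V((b_ℓ, Q_ℓ); β₋), where (b_ℓ, Q_ℓ) is the 1-uniform strategy bidding b_ℓ on Q_ℓ units. -/

import Mathlib

open Finset

namespace Auction

/-- A competing-bid profile for an auction of `K` identical units, represented by the
function sending `j ∈ {1,…,K}` to the `j`-th smallest element of the multiset of the
`K` largest competing bids. -/
structure Profile (K : ℕ) where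
  c : ℕ → ℝ
  mono : ∀ i j : ℕ, 1 ≤ i → i ≤ j → j ≤ K → c i ≤ c j
  nonneg : ∀ j : ℕ, 1 ≤ j → j ≤ K → 0 ≤ c j

/-- A bid vector: `n` units are demanded and `bid j` is the bid for the `j`-th unit
(for `1 ≤ j ≤ n`). -/
structure BidVec where
  n : ℕ
  bid : ℕ → ℝ

/-- A bid vector is valid if its bids are non-increasing and positive. -/
def BidVec.Valid (b : BidVec) : Prop :=
  (∀ i j : ℕ, 1 ≤ i → i ≤ j → j ≤ b.n → b.bid j ≤ b.bid i) ∧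
  ∀ j : ℕ, 1 ≤ j → j ≤ b.n → 0 < b.bid j

open Classical in
/-- The number of units the bidder wins (ties broken in the bidder's favor): the
largest `r ≤ min n K` such that the bidder's `j`-th bid is at least the `j`-th
threshold `β.c j` for every `j ≤ r`. -/
noncomputable def alloc (K : ℕ) (b : BidVec) (β : Profile K) : ℕ :=
  ((Finset.Icc 1 (min b.n K)).filter fun r => ∀ j ∈ Finset.Icc 1 r, β.c j ≤ b.bid j).sup id

/-- The clearing price: the `K`-th highest among all submitted bids (taken to be `0`
when the bidder wins no unit). -/
noncomputable def price (K : ℕ) (b : BidVec) (β : Profile K) : ℝ :=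
  if alloc K b β = 0 then 0
  else if alloc K b β < K then min (b.bid (alloc K b β)) (β.c (alloc K b β + 1))
  else b.bid K

/-- The value obtained by the bidder. -/
noncomputable def value (v : ℕ → ℝ) (K : ℕ) (b : BidVec) (β : Profile K) : ℝ :=
  ∑ j ∈ Finset.Icc 1 (alloc K b β), v j

/-- The bidder's total payment. -/
noncomputable def payment (K : ℕ) (b : BidVec) (β : Profile K) : ℝ :=
  price K b β * (alloc K b β : ℝ)

/-- The RoI constraint (with target RoI `γ = 0`) against a single competing-bid profile. -/
def Feasible (v : ℕ → ℝ) (K : ℕ) (b : BidVec) (β : Profile K) : Prop :=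
  payment K b β ≤ value v K b β

/-- A bid vector is safe if it satisfies the RoI constraint against every profile. -/
def Safe (v : ℕ → ℝ) (K : ℕ) (b : BidVec) : Prop :=
  ∀ β : Profile K, Feasible v K b β

/-- A valuation vector: nonnegative and non-increasing on `{1,…,M}`. -/
def ValidValuation (M : ℕ) (v : ℕ → ℝ) : Prop :=
  (∀ j : ℕ, 1 ≤ j → j ≤ M → 0 ≤ v j) ∧
  ∀ i j : ℕ, 1 ≤ i → i ≤ j → j ≤ M → v j ≤ v i

/-- The average cumulative valuation `w_j = (v_1 + ⋯ + v_j) / j`. -/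
noncomputable def w (v : ℕ → ℝ) (j : ℕ) : ℝ :=
  (∑ ℓ ∈ Finset.Icc 1 j, v ℓ) / (j : ℝ)

/-- An `m`-uniform bidding strategy: bid-quantity pairs `(b j, q j)` for `1 ≤ j ≤ m`. -/
structure Uniform where
  m : ℕ
  b : ℕ → ℝ
  q : ℕ → ℕ

/-- Cumulative quantities `Q j = q 1 + ⋯ + q j`. -/
def Uniform.Q (s : Uniform) (j : ℕ) : ℕ := ∑ ℓ ∈ Finset.Icc 1 j, s.q ℓ

/-- `s` is a genuine `m`-uniform strategy for maximum demand `M`: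
`b 1 > b 2 > ⋯ > b m > 0`, positive quantities, and `Q m ≤ M`. -/
def Uniform.IsUniform (M : ℕ) (s : Uniform) : Prop :=
  1 ≤ s.m ∧
  (∀ j : ℕ, 1 ≤ j → j ≤ s.m → 0 < s.q j) ∧
  0 < s.b s.m ∧
  (∀ j : ℕ, 1 ≤ j → j < s.m → s.b (j + 1) < s.b j) ∧
  s.Q s.m ≤ M

/-- The bid vector associated to a uniform strategy: the bid on the `j`-th unit is
`b ℓ`, where `ℓ` is least with `j ≤ Q ℓ`. -/
noncomputable def Uniform.toBidVec (s : Uniform) : BidVec :=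
  ⟨s.Q s.m, fun j => s.b (sInf {ℓ : ℕ | j ≤ s.Q ℓ})⟩

/-- The 1-uniform strategy bidding `b` on `q` units. -/
def single (b : ℝ) (q : ℕ) : Uniform := ⟨1, fun _ => b, fun _ => q⟩

/-- Membership in the class `𝒫*_{≤ m}` of safe undominated strategies with at most `m`
bid-quantity pairs: strategies determined by a tuple `0 < Q 1 < ⋯ < Q k ≤ M` (`k ≤ m`)
via `b ℓ = w (Q ℓ)` and `q ℓ = Q ℓ - Q (ℓ-1)`. -/
def InSafeClass (M : ℕ) (v : ℕ → ℝ) (m : ℕ) (s : Uniform) : Prop :=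
  1 ≤ s.m ∧ s.m ≤ m ∧ (∀ j : ℕ, 1 ≤ j → j ≤ s.m → 0 < s.q j) ∧ s.Q s.m ≤ M ∧
  ∀ ℓ : ℕ, 1 ≤ ℓ → ℓ ≤ s.m → s.b ℓ = w v (s.Q ℓ)

/-- Membership in the class `𝒬_{≤ m}(H)` of strategies with at most `m` bid-quantity
pairs that are RoI-feasible for the bid history `H` over rounds `1,…,T`. -/
def InFeasClass (M : ℕ) (v : ℕ → ℝ) (K T : ℕ) (H : ℕ → Profile K) (m : ℕ) (s : Uniform) : Prop :=
  s.IsUniform M ∧ s.m ≤ m ∧ ∀ t ∈ Finset.Icc 1 T, Feasible v K s.toBidVec (H t)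

/-- Total value obtained by strategy `s` over the bid history `H` on rounds `1,…,T`. -/
noncomputable def totalValue (v : ℕ → ℝ) (K T : ℕ) (H : ℕ → Profile K) (s : Uniform) : ℝ :=
  ∑ t ∈ Finset.Icc 1 T, value v K s.toBidVec (H t)

/-- The optimal total value over the class `𝒫*_{≤ m}`. -/
noncomputable def bestSafe (M : ℕ) (v : ℕ → ℝ) (K T : ℕ) (H : ℕ → Profile K) (m : ℕ) : ℝ :=
  sSup {x : ℝ | ∃ s : Uniform, InSafeClass M v m s ∧ x = totalValue v K T H s}

/-- The optimal total value over the class `𝒬_{≤ m}(H)`. -/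
noncomputable def bestFeas (M : ℕ) (v : ℕ → ℝ) (K T : ℕ) (H : ℕ → Profile K) (m : ℕ) : ℝ :=
  sSup {x : ℝ | ∃ s : Uniform, InFeasClass M v K T H m s ∧ x = totalValue v K T H s}

lemma alloc_le_min (K : ℕ) (b : BidVec) (β : Profile K) : alloc K b β ≤ min b.n K := by
  refine Finset.sup_le fun r hr => ?_
  simp only [Finset.mem_filter] at hr
  exact (Finset.mem_Icc.1 hr.1).2

lemma le_alloc {K : ℕ} {b : BidVec} {β : Profile K} {r : ℕ} (hn : r ≤ b.n) (hK : r ≤ K)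
    (h : ∀ j, 1 ≤ j → j ≤ r → β.c j ≤ b.bid j) : r ≤ alloc K b β := by
  rcases Nat.eq_zero_or_pos r with rfl | hr
  · exact Nat.zero_le _
  · refine Finset.le_sup (f := id) ?_
    simp only [Finset.mem_filter, Finset.mem_Icc]
    exact ⟨⟨hr, le_min hn hK⟩, fun j hj => h j hj.1 hj.2⟩

lemma le_bid_of_le_alloc {K : ℕ} {b : BidVec} {β : Profile K} {j : ℕ} (h1 : 1 ≤ j)
    (h : j ≤ alloc K b β) : β.c j ≤ b.bid j := by
  obtain ⟨r, hr, hjr⟩ := (Finset.le_sup_iff (f := id) (Nat.lt_of_succ_le h1)).1 h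
  simp only [Finset.mem_filter] at hr
  exact hr.2 j (Finset.mem_Icc.2 ⟨h1, hjr⟩)

lemma value_mono_of_alloc_le {K M : ℕ} {v : ℕ → ℝ} (hv : ValidValuation M v) {b b' : BidVec}
    {β : Profile K} (h : alloc K b β ≤ alloc K b' β) (hM : alloc K b' β ≤ M) :
    value v K b β ≤ value v K b' β := by
  refine Finset.sum_le_sum_of_subset_of_nonneg (Finset.Icc_subset_Icc_right h) fun j hj _ => ?_
  rw [Finset.mem_Icc] at hj
  exact hv.1 j hj.1 (hj.2.trans hM)

lemma Uniform.Q_mono (s : Uniform) : Monotone s.Q := fun _ _ h =>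
  Finset.sum_le_sum_of_subset (Finset.Icc_subset_Icc_right h)

lemma Uniform.IsUniform.b_anti {M : ℕ} {s : Uniform} (hs : s.IsUniform M) {i j : ℕ} (hi : 1 ≤ i)
    (hij : i ≤ j) (hj : j ≤ s.m) : s.b j ≤ s.b i := by
  induction j, hij using Nat.le_induction with
  | base => exact le_rfl
  | succ k hk ih =>
    exact (hs.2.2.2.1 k (hi.trans hk) hj).le.trans (ih (Nat.le_of_succ_le hj))

/-- Some block of the strategy contains the `j`-th unit and determines the bid on it. -/
lemma Uniform.exists_bid_eq (s : Uniform) {j ℓ : ℕ} (hj : 1 ≤ j) (hℓ : j ≤ s.Q ℓ) :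
    ∃ k, 1 ≤ k ∧ k ≤ ℓ ∧ j ≤ s.Q k ∧ s.toBidVec.bid j = s.b k := by
  have hmem : j ≤ s.Q (sInf {k : ℕ | j ≤ s.Q k}) :=
    Nat.sInf_mem (s := {k : ℕ | j ≤ s.Q k}) ⟨ℓ, hℓ⟩
  refine ⟨_, Nat.one_le_iff_ne_zero.2 fun h0 => ?_, Nat.sInf_le hℓ, hmem, rfl⟩
  rw [h0] at hmem
  simp [Uniform.Q] at hmem
  omega

lemma single_toBidVec_n (b : ℝ) (q : ℕ) : (single b q).toBidVec.n = q := by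
  simp [single, Uniform.toBidVec, Uniform.Q]

lemma alloc_single_le {K M : ℕ} {s : Uniform} (hs : s.IsUniform M) (β : Profile K) {ℓ : ℕ}
    (hℓ : ℓ ≤ s.m) :
    alloc K (single (s.b ℓ) (s.Q ℓ)).toBidVec β ≤ alloc K s.toBidVec β := by
  have hle := alloc_le_min K (single (s.b ℓ) (s.Q ℓ)).toBidVec β
  rw [single_toBidVec_n, le_min_iff] at hle
  refine le_alloc (hle.1.trans (s.Q_mono hℓ)) hle.2 fun j h1 hj => ?_
  obtain ⟨k, hk1, hkℓ, -, hbid⟩ := s.exists_bid_eq h1 (hj.trans hle.1)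
  rw [hbid]
  exact (le_bid_of_le_alloc h1 hj).trans (hs.b_anti hk1 hkℓ hℓ)

lemma exists_alloc_le_single {K M : ℕ} {s : Uniform} (hs : s.IsUniform M) (β : Profile K) :
    ∃ ℓ ∈ Finset.Icc 1 s.m,
      alloc K s.toBidVec β ≤ alloc K (single (s.b ℓ) (s.Q ℓ)).toBidVec β := by
  rcases Nat.eq_zero_or_pos (alloc K s.toBidVec β) with h0 | hpos
  · exact ⟨1, Finset.mem_Icc.2 ⟨le_rfl, hs.1⟩, h0 ▸ Nat.zero_le _⟩
  have hle := le_min_iff.1 (alloc_le_min K s.toBidVec β)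
  obtain ⟨k, hk1, hkm, hQ, hbid⟩ := s.exists_bid_eq hpos hle.1
  refine ⟨k, Finset.mem_Icc.2 ⟨hk1, hkm⟩, le_alloc ?_ hle.2 fun j h1 hj => ?_⟩
  · rwa [single_toBidVec_n]
  · exact (β.mono j _ h1 hj hle.2).trans ((le_bid_of_le_alloc hpos le_rfl).trans_eq hbid)

/-- Lemma `lem:sum-to-max-equivalence`: if the `m`-uniform strategy `b`
satisfies the RoI constraint against `β`, then
`V(b;β) = max_{ℓ ∈ {1,…,m}} V((b ℓ, Q ℓ); β)`. -/
theorem value_decomposition_feasible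
    (K M : ℕ) (v : ℕ → ℝ) (hv : ValidValuation M v) (hMK : M ≤ K)
    (s : Uniform) (hs : s.IsUniform M) (β : Profile K)
    (hfeas : Feasible v K s.toBidVec β) :
    value v K s.toBidVec β =
      (Finset.Icc 1 s.m).sup' (Finset.nonempty_Icc.mpr hs.1)
        (fun ℓ => value v K (single (s.b ℓ) (s.Q ℓ)).toBidVec β) := by
  have hM : alloc K s.toBidVec β ≤ M :=
    ((alloc_le_min K s.toBidVec β).trans (min_le_left _ _)).trans hs.2.2.2.2
  apply le_antisymm
  · obtain ⟨ℓ, hℓ, h⟩ := exists_alloc_le_single hs β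
    have h' := alloc_single_le hs β (Finset.mem_Icc.1 hℓ).2
    exact Finset.le_sup'_of_le _ hℓ (value_mono_of_alloc_le hv h (h'.trans hM))
  · refine Finset.sup'_le _ _ fun ℓ hℓ => ?_
    exact value_mono_of_alloc_le hv (alloc_single_le hs β (Finset.mem_Icc.1 hℓ).2) hM

end Auction
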